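/- arXiv:1610.07030 — 7 statements merged into one kernel-verified Lean document; each statement's English description precedes it below -/
import Mathlib

section
/- For every natural number n ≥ 0 and every x ≥ 0, cosh( (2n+1) · arsinh(√x) ) = √(1+x) · ∏_{k=1}^{n} (1 + x / a_k), where a_k = sin²( (π/2) · (2k−1)/(2n+1) ). -/
open Real Finset

open Polynomial in
/-- The polynomial `P` of degree `n` with `cosh ((2 * n + 1) * t) = cosh t * P (sinh t ^ 2)`. -/
noncomputable def coshOddPoly : ℕ → ℝ[X]
  | 0 => 1
  | 1 => 4 * X + 1
  | n + 2 => (4 * X + 2) * coshOddPoly (n + 1) - coshOddPoly n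

theorem coshOddPoly_natDegree_le : ∀ n : ℕ, (coshOddPoly n).natDegree ≤ n
  | 0 => by simp [coshOddPoly]
  | 1 => by
    rw [coshOddPoly]
    compute_degree
  | n + 2 => by
    have h₀ := coshOddPoly_natDegree_le n
    have h₁ := coshOddPoly_natDegree_le (n + 1)
    have h₂ : (4 * Polynomial.X + 2 : Polynomial ℝ).natDegree ≤ 1 := by compute_degree
    rw [coshOddPoly]
    refine Polynomial.natDegree_sub_le_of_le (Polynomial.natDegree_mul_le.trans ?_) ?_ |>.trans
      (max_self (n + 2)).le <;> omega

theorem coshOddPoly_eval_zero : ∀ n : ℕ, (coshOddPoly n).eval 0 = 1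
  | 0 => by simp [coshOddPoly]
  | 1 => by simp [coshOddPoly]
  | n + 2 => by
    simp [coshOddPoly, coshOddPoly_eval_zero n, coshOddPoly_eval_zero (n + 1)]
    norm_num

theorem cosh_mul_coshOddPoly_eval (t : ℝ) :
    ∀ n : ℕ, cosh t * (coshOddPoly n).eval (sinh t ^ 2) = cosh ((2 * (n : ℝ) + 1) * t)
  | 0 => by simp [coshOddPoly]
  | 1 => by
    have h : (2 * ((1 : ℕ) : ℝ) + 1) * t = 3 * t := by push_cast; ring
    rw [h, cosh_three_mul]
    simp only [coshOddPoly, Polynomial.eval_add, Polynomial.eval_mul, Polynomial.eval_ofNat,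
      Polynomial.eval_X, Polynomial.eval_one, sinh_sq]
    ring
  | n + 2 => by
    have h₀ := cosh_mul_coshOddPoly_eval t n
    have h₁ := cosh_mul_coshOddPoly_eval t (n + 1)
    set s : ℝ := (2 * ((n + 1 : ℕ) : ℝ) + 1) * t with hs
    have hl : (2 * (n : ℝ) + 1) * t = s - 2 * t := by rw [hs]; push_cast; ring
    have hr : (2 * ((n + 2 : ℕ) : ℝ) + 1) * t = s + 2 * t := by rw [hs]; push_cast; ring
    rw [hl, cosh_sub, cosh_two_mul, cosh_sq] at h₀
    rw [hr, cosh_add, cosh_two_mul, cosh_sq]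
    simp only [coshOddPoly, Polynomial.eval_sub, Polynomial.eval_add, Polynomial.eval_mul,
      Polynomial.eval_ofNat, Polynomial.eval_X]
    linear_combination (4 * sinh t ^ 2 + 2) * h₁ - h₀

theorem cos_mul_coshOddPoly_eval (θ : ℝ) :
    ∀ n : ℕ, cos θ * (coshOddPoly n).eval (-sin θ ^ 2) = cos ((2 * (n : ℝ) + 1) * θ)
  | 0 => by simp [coshOddPoly]
  | 1 => by
    have h : (2 * ((1 : ℕ) : ℝ) + 1) * θ = 3 * θ := by push_cast; ring
    rw [h, cos_three_mul]
    simp only [coshOddPoly, Polynomial.eval_add, Polynomial.eval_mul, Polynomial.eval_ofNat,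
      Polynomial.eval_X, Polynomial.eval_one, sin_sq]
    ring
  | n + 2 => by
    have h₀ := cos_mul_coshOddPoly_eval θ n
    have h₁ := cos_mul_coshOddPoly_eval θ (n + 1)
    set s : ℝ := (2 * ((n + 1 : ℕ) : ℝ) + 1) * θ with hs
    have hl : (2 * (n : ℝ) + 1) * θ = s - 2 * θ := by rw [hs]; push_cast; ring
    have hr : (2 * ((n + 2 : ℕ) : ℝ) + 1) * θ = s + 2 * θ := by rw [hs]; push_cast; ring
    rw [hl, cos_sub, cos_two_mul, cos_sq'] at h₀
    rw [hr, cos_add, cos_two_mul, cos_sq']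
    simp only [coshOddPoly, Polynomial.eval_sub, Polynomial.eval_add, Polynomial.eval_mul,
      Polynomial.eval_ofNat, Polynomial.eval_X]
    linear_combination (-4 * sin θ ^ 2 + 2) * h₁ - h₀

theorem oddAngle_mem_Ioo {n k : ℕ} (hk : k ∈ Icc 1 n) :
    π / 2 * (2 * (k : ℝ) - 1) / (2 * (n : ℝ) + 1) ∈ Set.Ioo 0 (π / 2) := by
  obtain ⟨h₁, h₂⟩ := mem_Icc.mp hk
  have h₁' : (1 : ℝ) ≤ k := by exact_mod_cast h₁
  have h₂' : (k : ℝ) ≤ n := by exact_mod_cast h₂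
  have hπ := pi_pos
  constructor
  · have : 0 < 2 * (k : ℝ) - 1 := by linarith
    positivity
  · rw [div_lt_iff₀ (by positivity)]
    gcongr
    linarith

theorem sin_oddAngle_pos {n k : ℕ} (hk : k ∈ Icc 1 n) :
    0 < sin (π / 2 * (2 * (k : ℝ) - 1) / (2 * (n : ℝ) + 1)) := by
  obtain ⟨h₁, h₂⟩ := oddAngle_mem_Ioo hk
  exact sin_pos_of_pos_of_lt_pi h₁ (by linarith [pi_pos])

theorem coshOddPoly_eval_neg_sin_sq {n k : ℕ} (hk : k ∈ Icc 1 n) :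
    (coshOddPoly n).eval (-sin (π / 2 * (2 * (k : ℝ) - 1) / (2 * (n : ℝ) + 1)) ^ 2) = 0 := by
  obtain ⟨h₁, h₂⟩ := oddAngle_mem_Ioo hk
  have hcos := cos_pos_of_mem_Ioo ⟨by linarith [pi_pos], h₂⟩
  refine (mul_eq_zero.mp ((cos_mul_coshOddPoly_eval _ n).trans ?_)).resolve_left hcos.ne'
  rw [mul_div_cancel₀ _ (by positivity), cos_eq_zero_iff]
  exact ⟨(k : ℤ) - 1, by push_cast; ring⟩

theorem injOn_neg_sin_sq_oddAngle (n : ℕ) :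
    Set.InjOn (fun k : ℕ ↦ -sin (π / 2 * (2 * (k : ℝ) - 1) / (2 * (n : ℝ) + 1)) ^ 2)
      (Icc 1 n : Finset ℕ) := by
  intro j hj k hk hjk
  have hsin := (sq_eq_sq₀ (sin_oddAngle_pos hj).le (sin_oddAngle_pos hk).le).mp (neg_injective hjk)
  obtain ⟨hj₁, hj₂⟩ := oddAngle_mem_Ioo hj
  obtain ⟨hk₁, hk₂⟩ := oddAngle_mem_Ioo hk
  have hangle := injOn_sin ⟨by linarith [pi_pos], hj₂.le⟩ ⟨by linarith [pi_pos], hk₂.le⟩ hsin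
  have hn : (2 * (n : ℝ) + 1) ≠ 0 := by positivity
  have hmul := mul_left_cancel₀ (by positivity) ((div_left_inj' hn).mp hangle)
  have : (j : ℝ) = k := by linarith
  exact_mod_cast this

open Polynomial in
theorem coshOddPoly_eq_prod (n : ℕ) :
    coshOddPoly n = ∏ k ∈ Icc 1 n,
      (1 + C (sin (π / 2 * (2 * (k : ℝ) - 1) / (2 * (n : ℝ) + 1)) ^ 2)⁻¹ * X) := by
  set r : ℕ → ℝ := fun k ↦ -sin (π / 2 * (2 * (k : ℝ) - 1) / (2 * (n : ℝ) + 1)) ^ 2 with hr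
  have hzero : (0 : ℝ) ∉ (Icc 1 n).image r := by
    intro h
    obtain ⟨k, hk, hk₀⟩ := mem_image.mp h
    exact (neg_lt_zero.mpr (pow_pos (sin_oddAngle_pos hk) 2)).ne hk₀
  have hcard : (insert 0 ((Icc 1 n).image r)).card = n + 1 := by
    rw [card_insert_of_notMem hzero, card_image_of_injOn (injOn_neg_sin_sq_oddAngle n),
      Nat.card_Icc, Nat.add_sub_cancel]
  refine eq_of_degrees_lt_of_eval_finset_eq (insert 0 ((Icc 1 n).image r)) ?_ ?_ ?_
  · rw [hcard]
    exact (degree_le_of_natDegree_le (coshOddPoly_natDegree_le n)).trans_lt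
      (Nat.cast_lt.mpr n.lt_succ_self)
  · rw [hcard]
    refine (degree_le_of_natDegree_le ?_).trans_lt
      (Nat.cast_lt.mpr n.lt_succ_self)
    refine (natDegree_prod_le _ _).trans ((sum_le_card_nsmul _ _ 1 fun k _ ↦ ?_).trans ?_)
    · compute_degree
    · simp
  · intro y hy
    obtain rfl | hy := mem_insert.mp hy
    · simp [coshOddPoly_eval_zero, eval_prod]
    · obtain ⟨k, hk, rfl⟩ := mem_image.mp hy
      rw [coshOddPoly_eval_neg_sin_sq hk, eval_prod, prod_eq_zero hk]
      simp [hr, (sin_oddAngle_pos hk).ne']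

theorem cosh_odd_arsinh_prod (n : ℕ) (x : ℝ) (hx : 0 ≤ x) :
    Real.cosh ((2 * (n : ℝ) + 1) * Real.arsinh (Real.sqrt x))
      = Real.sqrt (1 + x) *
        ∏ k ∈ Finset.Icc 1 n,
          (1 + x / Real.sin (π / 2 * (2 * (k : ℝ) - 1) / (2 * (n : ℝ) + 1)) ^ 2) := by
  rw [← cosh_mul_coshOddPoly_eval, cosh_arsinh, sinh_arsinh, sq_sqrt hx, coshOddPoly_eq_prod,
    Polynomial.eval_prod]
  simp [div_eq_inv_mul]
end

section
/- For every natural number n ≥ 1 and every x ≥ 0, cosh( 2n · arsinh(√x) ) = ∏_{k=1}^{n} (1 + x / b_k), where b_k = sin²( (π/2) · (2k−1)/(2n) ). -/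
open Real Finset

open Polynomial in
/-- The Chebyshev polynomial `T n` factors over its roots, normalised by `T n 1 = 1`. -/
lemma Polynomial.Chebyshev.eval_T_real_eq_prod_div (n : ℕ) (y : ℝ) :
    (Chebyshev.T ℝ n).eval y =
      ∏ k ∈ Finset.range n,
        (y - cos ((2 * k + 1) * π / (2 * n))) / (1 - cos ((2 * k + 1) * π / (2 * n))) := by
  have hroots : (Chebyshev.T ℝ n).roots =
      (Multiset.range n).map (fun k : ℕ ↦ cos ((2 * k + 1) * π / (2 * n))) := by
    rw [Chebyshev.roots_T_real, Finset.image_val, Finset.range_val,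
      (Chebyshev.roots_T_real_nodup n).dedup]
  have hcard : (Chebyshev.T ℝ n).roots.card = (Chebyshev.T ℝ n).natDegree := by
    simp [hroots]
  have heval (z : ℝ) : (Chebyshev.T ℝ n).eval z = (Chebyshev.T ℝ n).leadingCoeff *
      ∏ k ∈ Finset.range n, (z - cos ((2 * k + 1) * π / (2 * n))) := by
    conv_lhs => rw [← C_leadingCoeff_mul_prod_multiset_X_sub_C hcard, hroots]
    simp [eval_multiset_prod, Finset.prod]
  have hone := heval 1
  rw [Chebyshev.T_eval_one] at hone
  rw [Finset.prod_div_distrib, heval y, eq_div_iff (right_ne_zero_of_mul (hone ▸ one_ne_zero)),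
    mul_right_comm, ← hone, one_mul]

theorem cosh_even_arsinh_prod (n : ℕ) (hn : 1 ≤ n) (x : ℝ) (hx : 0 ≤ x) :
    Real.cosh (2 * (n : ℝ) * Real.arsinh (Real.sqrt x))
      = ∏ k ∈ Finset.Icc 1 n,
          (1 + x / Real.sin (π / 2 * (2 * (k : ℝ) - 1) / (2 * (n : ℝ))) ^ 2) := by
  have hcosh : cosh (2 * arsinh √x) = 1 + 2 * x := by
    rw [cosh_two_mul, cosh_sq, sinh_arsinh, sq_sqrt hx]
    ring
  have hT := Polynomial.Chebyshev.T_real_cosh (2 * arsinh √x) n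
  rw [hcosh, Polynomial.Chebyshev.eval_T_real_eq_prod_div, Int.cast_natCast] at hT
  rw [mul_assoc, mul_left_comm, ← hT, ← Finset.Ico_add_one_right_eq_Icc,
    Finset.prod_Ico_eq_prod_range, Nat.add_sub_cancel]
  refine Finset.prod_congr rfl fun k hk ↦ ?_
  have hn' : (0 : ℝ) < n := by exact_mod_cast hn
  have hk' : (k : ℝ) + 1 ≤ n := by exact_mod_cast Finset.mem_range.mp hk
  set t : ℝ := π / 2 * (2 * ((1 + k : ℕ) : ℝ) - 1) / (2 * n) with ht
  have ht' : t = (2 * k + 1) * π / (4 * n) := by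
    rw [ht]
    push_cast
    ring
  have hsin : 0 < sin t := by
    refine sin_pos_of_pos_of_lt_pi (by rw [ht']; positivity) ?_
    rw [ht', div_lt_iff₀ (by positivity)]
    nlinarith [pi_pos]
  have hcos : cos ((2 * k + 1) * π / (2 * n)) = 1 - 2 * sin t ^ 2 := by
    rw [show (2 * k + 1) * π / (2 * n) = 2 * t by rw [ht']; ring, cos_two_mul, cos_sq']
    ring
  rw [hcos, sub_sub_cancel]
  field_simp
  ring
end

section
/- For every natural number n ≥ 1 and every x ≥ 0, log( cosh( 2n · arsinh(√x) ) ) = ∫_0^∞ (1 − e^{−x z}) · ( ∑_{k=1}^{n} e^{−b_k z} ) · z^{−1} dz, where b_k = sin²( (π/2) · (2k−1)/(2n) ). In particular, the Laplace exponent −log f_{2n} with f_{2n}(x) = 1/cosh(2n·arsinh√x) is represented by the Lévy measure ν(dz) = (∑_{k=1}^{n} e^{−b_k z}) z^{−1} dz on (0,∞). -/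
open Real Finset MeasureTheory

/-- The Chebyshev polynomial `T n` is the product of its linear factors. -/
theorem Polynomial.Chebyshev.eval_T_real_eq_prod (n : ℕ) (y : ℝ) :
    (Polynomial.Chebyshev.T ℝ n).eval y = (Polynomial.Chebyshev.T ℝ n).leadingCoeff *
      ∏ k ∈ Finset.range n, (y - cos ((2 * (k : ℝ) + 1) * π / (2 * n))) := by
  have hinj : Set.InjOn (fun k : ℕ ↦ cos ((2 * (k : ℝ) + 1) * π / (2 * n))) (Finset.range n) :=
    (Finset.range n).nodup_map_iff_injOn.mp (Polynomial.Chebyshev.roots_T_real_nodup n)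
  have hcard : Multiset.card (Polynomial.Chebyshev.T ℝ n).roots =
      (Polynomial.Chebyshev.T ℝ n).natDegree := by
    rw [Polynomial.Chebyshev.roots_T_real, Finset.card_val, Finset.card_image_of_injOn hinj,
      Finset.card_range, Polynomial.Chebyshev.natDegree_T, Int.natAbs_natCast]
  rw [(Polynomial.splits_iff_card_roots.mpr hcard).eval_eq_prod_roots,
    Polynomial.Chebyshev.roots_T_real]
  congr 1
  exact Finset.prod_image hinj

/-- The Chebyshev polynomial `T n` at `1 + 2 * x`, factored through `sin ^ 2` of half angles. -/
theorem Polynomial.Chebyshev.eval_T_real_one_add_two_mul_eq_prod (n : ℕ) (x : ℝ) :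
    (Polynomial.Chebyshev.T ℝ n).eval (1 + 2 * x) =
      ∏ k ∈ Finset.Icc 1 n, ((sin (π / 2 * (2 * (k : ℝ) - 1) / (2 * (n : ℝ))) ^ 2 + x) /
        sin (π / 2 * (2 * (k : ℝ) - 1) / (2 * (n : ℝ))) ^ 2) := by
  have hfac (y : ℝ) : (Polynomial.Chebyshev.T ℝ n).eval (1 + 2 * y) =
      (Polynomial.Chebyshev.T ℝ n).leadingCoeff * ∏ k ∈ Finset.Icc 1 n,
        (2 * (sin (π / 2 * (2 * (k : ℝ) - 1) / (2 * (n : ℝ))) ^ 2 + y)) := by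
    rw [Polynomial.Chebyshev.eval_T_real_eq_prod, Finset.range_eq_Ico,
      ← Finset.Ico_add_one_right_eq_Icc, ← Finset.prod_Ico_add' _ 0 n 1]
    congr 1
    refine Finset.prod_congr rfl fun k _ ↦ ?_
    rw [show (2 * (k : ℝ) + 1) * π / (2 * n) =
      2 * (π / 2 * (2 * ((k + 1 : ℕ) : ℝ) - 1) / (2 * (n : ℝ))) by push_cast; ring,
      cos_two_mul, cos_sq']
    ring
  have hone := hfac 0
  rw [mul_zero, add_zero, Polynomial.Chebyshev.T_eval_one] at hone
  have hlead : (Polynomial.Chebyshev.T ℝ n).leadingCoeff ≠ 0 := fun h ↦ by simp [h] at hone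
  rw [hfac x, ← div_one (_ * _), congrArg (_ / ·) hone, mul_div_mul_left _ _ hlead, ← Finset.prod_div_distrib]
  refine Finset.prod_congr rfl fun k _ ↦ ?_
  rw [add_zero, mul_div_mul_left _ _ two_ne_zero]

theorem Real.cosh_nat_mul_two_mul_arsinh_sqrt (n : ℕ) {x : ℝ} (hx : 0 ≤ x) :
    cosh (2 * (n : ℝ) * arsinh (√x)) = (Polynomial.Chebyshev.T ℝ n).eval (1 + 2 * x) := by
  have h : cosh (2 * arsinh (√x)) = 1 + 2 * x := by
    rw [cosh_two_mul, cosh_sq, sinh_arsinh, sq_sqrt hx]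
    ring
  rw [← h, Polynomial.Chebyshev.T_real_cosh]
  push_cast
  ring_nf

theorem integrableOn_Ioi_one_sub_exp_mul_exp_div {b x : ℝ} (hb : 0 < b) (hx : 0 ≤ x) :
    IntegrableOn (fun z ↦ (1 - exp (-x * z)) * exp (-b * z) / z) (Set.Ioi 0) := by
  refine ((exp_neg_integrableOn_Ioi 0 hb).const_mul x).mono'
    (Measurable.aestronglyMeasurable (by fun_prop))
    ((ae_restrict_iff' measurableSet_Ioi).mpr (.of_forall fun z (hz : 0 < z) ↦ ?_))
  have hle : exp (-x * z) ≤ 1 := exp_le_one_iff.mpr (by nlinarith)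
  have hge : 1 - exp (-x * z) ≤ x * z := by linarith [add_one_le_exp (-x * z)]
  rw [norm_of_nonneg (by have := sub_nonneg.mpr hle; positivity), div_le_iff₀ hz]
  nlinarith [exp_pos (-b * z)]

/-- Frullani's integral for the exponential, as a Lévy–Khintchine representation. -/
theorem integral_Ioi_one_sub_exp_mul_exp_div {b x : ℝ} (hb : 0 < b) (hx : 0 ≤ x) :
    ∫ z in Set.Ioi 0, (1 - exp (-x * z)) * exp (-b * z) / z = log ((b + x) / b) := by
  have heq : (fun z ↦ (1 - exp (-x * z)) * exp (-b * z) / z) =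
      fun z ↦ z⁻¹ • (exp (-(b * z)) - exp (-((b + x) * z))) := by
    ext z
    rw [show -((b + x) * z) = -x * z + -b * z by ring, exp_add, smul_eq_mul, neg_mul b]
    ring
  have hint := integrableOn_Ioi_one_sub_exp_mul_exp_div hb hx
  rw [heq] at hint ⊢
  have hcont : Continuous fun z : ℝ ↦ exp (-z) := by fun_prop
  have hzero : Filter.Tendsto (fun z : ℝ ↦ exp (-z)) (nhdsWithin 0 (Set.Ioi 0)) (nhds 1) := by
    simpa using (hcont.tendsto 0).mono_left nhdsWithin_le_nhds
  have := Frullani.integral_Ioi_eq (f := fun z ↦ exp (-z))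
    (hcont.locallyIntegrable.locallyIntegrableOn _) hb (by positivity : 0 < b + x) hzero
    tendsto_exp_neg_atTop_nhds_zero hint
  simpa using this

theorem log_cosh_even_levy_representation (n : ℕ) (hn : 1 ≤ n) (x : ℝ) (hx : 0 ≤ x) :
    Real.log (Real.cosh (2 * (n : ℝ) * Real.arsinh (Real.sqrt x)))
      = ∫ z in Set.Ioi (0 : ℝ),
          (1 - Real.exp (-x * z)) *
            (∑ k ∈ Finset.Icc 1 n,
              Real.exp (-(Real.sin (π / 2 * (2 * (k : ℝ) - 1) / (2 * (n : ℝ))) ^ 2) * z)) / z := by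
  have hb : ∀ k ∈ Finset.Icc 1 n, 0 < sin (π / 2 * (2 * (k : ℝ) - 1) / (2 * (n : ℝ))) ^ 2 := by
    intro k hk
    obtain ⟨hk₁, hk₂⟩ := Finset.mem_Icc.mp hk
    have hk₁' : (1 : ℝ) ≤ k := by exact_mod_cast hk₁
    have hk₂' : (k : ℝ) ≤ n := by exact_mod_cast hk₂
    have hpos : (0 : ℝ) < 2 * k - 1 := by linarith
    have hn' : (0 : ℝ) < n := by linarith
    refine pow_pos (sin_pos_of_pos_of_lt_pi (by positivity) ?_) 2
    rw [div_lt_iff₀ (by positivity)]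
    nlinarith [pi_pos]
  rw [cosh_nat_mul_two_mul_arsinh_sqrt n hx,
    Polynomial.Chebyshev.eval_T_real_one_add_two_mul_eq_prod n x,
    log_prod fun k hk ↦ (div_pos (add_pos_of_pos_of_nonneg (hb k hk) hx) (hb k hk)).ne']
  simp_rw [Finset.mul_sum, Finset.sum_div]
  rw [integral_finsetSum _ fun k hk ↦ integrableOn_Ioi_one_sub_exp_mul_exp_div (hb k hk) hx]
  exact Finset.sum_congr rfl fun k hk ↦
    (integral_Ioi_one_sub_exp_mul_exp_div (hb k hk) hx).symm
end

section
/- For every natural number n ≥ 0 and every x ≥ 0, log( cosh( (2n+1) · arsinh(√x) ) ) − (1/2) · log(1+x) = ∫_0^∞ (1 − e^{−x z}) · ( ∑_{k=1}^{n} e^{−a_k z} ) · z^{−1} dz, where a_k = sin²( (π/2) · (2k−1)/(2n+1) ). -/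
open Real Finset MeasureTheory

/-- The Chebyshev polynomial of the first kind as a product over its roots. -/
theorem eval_chebyshev_T_eq_prod (N : ℕ) (c : ℝ) :
    (Polynomial.Chebyshev.T ℝ N).eval c =
      2 ^ (N - 1) * ∏ k ∈ range N, (c - cos ((2 * (k : ℝ) + 1) * π / (2 * N))) := by
  have hinj : Set.InjOn (fun k : ℕ => cos ((2 * (k : ℝ) + 1) * π / (2 * N))) (range N) :=
    (range N).nodup_map_iff_injOn.mp (Polynomial.Chebyshev.roots_T_real_nodup N)
  have hroots := Polynomial.Chebyshev.roots_T_real N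
  have hcard : (Polynomial.Chebyshev.T ℝ N).roots.card =
      (Polynomial.Chebyshev.T ℝ N).natDegree := by
    rw [hroots, Finset.card_val, Finset.card_image_of_injOn hinj]
    simp
  have h := congrArg (Polynomial.eval c)
    (Polynomial.C_leadingCoeff_mul_prod_multiset_X_sub_C hcard)
  rw [← h, hroots, ← Finset.prod_eq_multiset_prod, Finset.prod_image hinj]
  simp [Polynomial.eval_prod]

/-- The quotient `cosh ((2 * n + 1) * θ) / cosh θ` as a product in `sinh θ ^ 2`, up to the
constant `4 ^ n`. -/
theorem cosh_odd_mul_eq_prod (n : ℕ) (θ : ℝ) :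
    cosh ((2 * (n : ℝ) + 1) * θ) = 4 ^ n * cosh θ *
      ∏ k ∈ Icc 1 n, (sinh θ ^ 2 + sin (π / 2 * (2 * (k : ℝ) - 1) / (2 * (n : ℝ) + 1)) ^ 2) := by
  have hT := Polynomial.Chebyshev.T_real_cosh θ ((2 * n + 1 : ℕ) : ℤ)
  have hpos : (0 : ℝ) < 2 * n + 1 := by positivity
  rw [eval_chebyshev_T_eq_prod] at hT
  push_cast at hT
  rw [← hT, pow_mul, show 2 * n + 1 = n + 1 + n by ring, prod_range_add,
    prod_range_succ, ← prod_range_reflect (fun k => cosh θ - _) n, mul_right_comm (∏ _ ∈ _, _),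
    ← prod_mul_distrib]
  have hmid : cos ((2 * (n : ℝ) + 1) * π / (2 * (2 * n + 1))) = 0 := by
    rw [show (2 * (n : ℝ) + 1) * π / (2 * (2 * n + 1)) = π / 2 by field_simp, cos_pi_div_two]
  rw [hmid, sub_zero, ← Finset.Ico_add_one_right_eq_Icc, Finset.prod_Ico_eq_prod_range,
    Nat.add_sub_cancel, ← prod_range_reflect (fun k => sinh θ ^ 2 + _) n]
  have hprod : ∀ k ∈ range n,
      (cosh θ - cos ((2 * ((n - 1 - k : ℕ) : ℝ) + 1) * π / (2 * (2 * n + 1)))) *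
        (cosh θ - cos ((2 * ((n + 1 + k : ℕ) : ℝ) + 1) * π / (2 * (2 * n + 1)))) =
      sinh θ ^ 2 + sin (π / 2 * (2 * ((1 + (n - 1 - k) : ℕ) : ℝ) - 1) / (2 * (n : ℝ) + 1)) ^ 2 := by
    intro k hk
    have hk' := mem_range.mp hk
    obtain ⟨j, rfl⟩ : ∃ j, n = k + 1 + j := ⟨n - 1 - k, by omega⟩
    rw [show k + 1 + j - 1 - k = j by omega]
    push_cast at hpos ⊢
    have h1 : π / 2 * (2 * (1 + (j : ℝ)) - 1) / (2 * (k + 1 + j) + 1) =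
        (2 * j + 1) * π / (2 * (2 * (k + 1 + j) + 1)) := by
      field_simp
      ring
    have h2 : (2 * ((k : ℝ) + 1 + j + 1 + k) + 1) * π / (2 * (2 * (k + 1 + j) + 1)) =
        π - (2 * j + 1) * π / (2 * (2 * (k + 1 + j) + 1)) := by
      field_simp
      ring
    rw [h1, h2, cos_pi_sub, sin_sq]
    linear_combination cosh_sq θ
  rw [prod_congr rfl hprod]
  norm_num
  ring

/-- The Frullani integrand for the exponential is integrable. -/
theorem integrableOn_one_sub_exp_mul_exp_div {a x : ℝ} (ha : 0 < a) (hx : 0 ≤ x) :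
    IntegrableOn (fun z => (1 - exp (-x * z)) * exp (-a * z) / z) (Set.Ioi 0) := by
  refine Integrable.mono' ((exp_neg_integrableOn_Ioi 0 ha).const_mul x)
    (Measurable.aestronglyMeasurable (by fun_prop)) ?_
  refine (ae_restrict_iff' measurableSet_Ioi).2 (.of_forall fun z (hz : 0 < z) => ?_)
  have h0 : 0 ≤ 1 - exp (-x * z) := by
    rw [sub_nonneg, exp_le_one_iff]
    nlinarith
  have h1 : 1 - exp (-x * z) ≤ x * z := by
    linarith [add_one_le_exp (-x * z)]
  rw [norm_of_nonneg (by positivity), div_le_iff₀ hz, mul_right_comm]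
  gcongr

/-- Frullani's integral for the exponential. -/
theorem integral_one_sub_exp_mul_exp_div {a x : ℝ} (ha : 0 < a) (hx : 0 ≤ x) :
    ∫ z in Set.Ioi (0 : ℝ), (1 - exp (-x * z)) * exp (-a * z) / z = log ((a + x) / a) := by
  have heq : (fun z : ℝ => (1 - exp (-x * z)) * exp (-a * z) / z) =
      fun z => z⁻¹ • (exp (-(a * z)) - exp (-((a + x) * z))) := by
    funext z
    rw [smul_eq_mul, show -((a + x) * z) = -x * z + -a * z by ring, exp_add, neg_mul a]
    ring
  have hint := integrableOn_one_sub_exp_mul_exp_div ha hx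
  rw [heq] at hint ⊢
  rw [Frullani.integral_Ioi_eq (f := fun t => exp (-t)) (L := 1) (R := 0)
    ((Continuous.locallyIntegrable (by fun_prop)).locallyIntegrableOn _) ha (by linarith) ?_
    tendsto_exp_neg_atTop_nhds_zero hint]
  · simp
  · have : Continuous fun t : ℝ => exp (-t) := by fun_prop
    simpa using (this.tendsto 0).mono_left nhdsWithin_le_nhds

theorem log_cosh_odd_levy_representation (n : ℕ) (x : ℝ) (hx : 0 ≤ x) :
    Real.log (Real.cosh ((2 * (n : ℝ) + 1) * Real.arsinh (Real.sqrt x)))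
        - (1 / 2) * Real.log (1 + x)
      = ∫ z in Set.Ioi (0 : ℝ),
          (1 - Real.exp (-x * z)) *
            (∑ k ∈ Finset.Icc 1 n,
              Real.exp (-(Real.sin (π / 2 * (2 * (k : ℝ) - 1) / (2 * (n : ℝ) + 1)) ^ 2) * z)) / z := by
  set a : ℕ → ℝ := fun k => sin (π / 2 * (2 * (k : ℝ) - 1) / (2 * (n : ℝ) + 1)) ^ 2 with ha_def
  have ha : ∀ k ∈ Icc 1 n, 0 < a k := by
    intro k hk
    obtain ⟨h1, h2⟩ := mem_Icc.mp hk
    have h1' : (1 : ℝ) ≤ k := by exact_mod_cast h1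
    have h2' : (k : ℝ) ≤ n := by exact_mod_cast h2
    have hpos : (0 : ℝ) < 2 * n + 1 := by positivity
    refine pow_pos (sin_pos_of_pos_of_lt_pi ?_ ?_) 2
    · have : (0 : ℝ) < 2 * k - 1 := by linarith
      positivity
    · rw [div_lt_iff₀ hpos]
      nlinarith [pi_pos]
  have hconst : 4 ^ n * ∏ k ∈ Icc 1 n, a k = 1 := by
    simpa using (cosh_odd_mul_eq_prod n 0).symm
  have hcosh : cosh ((2 * (n : ℝ) + 1) * arsinh (√x)) =
      √(1 + x) * ∏ k ∈ Icc 1 n, (a k + x) / a k := by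
    have hne : ∏ k ∈ Icc 1 n, a k ≠ 0 := prod_ne_zero_iff.mpr fun k hk => (ha k hk).ne'
    rw [cosh_odd_mul_eq_prod, sinh_arsinh, cosh_arsinh, sq_sqrt hx, prod_div_distrib,
      eq_div_of_mul_eq hne hconst]
    simp only [add_comm x, ha_def]
    ring
  have hfac : ∀ k ∈ Icc 1 n, 0 < (a k + x) / a k := fun k hk =>
    div_pos (by linarith [ha k hk]) (ha k hk)
  rw [hcosh, log_mul (by positivity) (prod_pos hfac).ne', log_sqrt (by positivity),
    log_prod fun k hk => (hfac k hk).ne']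
  simp_rw [mul_sum, sum_div]
  rw [integral_finsetSum _ fun k hk => integrableOn_one_sub_exp_mul_exp_div (ha k hk) hx,
    sum_congr rfl fun k hk => integral_one_sub_exp_mul_exp_div (ha k hk) hx]
  ring
end

section
/- For every real x, the infinite product ∏_{k=1}^{∞} (1 + x² / d_k) with d_k = (π(2k−1)/2)² is multipliable and its value equals cosh(x), i.e. cosh(x) = ∏_{k=1}^{∞} (1 + 4x² / (π² (2k−1)²)). -/
open Real

/-- Euler's product for the hyperbolic sine. -/
theorem tendsto_euler_sinh_prod (x : ℝ) :
    Filter.Tendsto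
      (fun n : ℕ => x * ∏ j ∈ Finset.range n, (1 + x ^ 2 / (π ^ 2 * ((j : ℝ) + 1) ^ 2)))
      Filter.atTop (nhds (Real.sinh x)) := by
  have hpi : (π : ℂ) ≠ 0 := by exact_mod_cast pi_ne_zero
  have h := (Complex.continuous_im.tendsto _).comp
    (Complex.tendsto_euler_sin_prod ((x / π : ℝ) * Complex.I))
  have hlim : Complex.sin (π * ((x / π : ℝ) * Complex.I)) = (Real.sinh x : ℂ) * Complex.I := by
    have harg : (π : ℂ) * ((x / π : ℝ) * Complex.I) = x * Complex.I := by
      push_cast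
      field_simp
    rw [harg, Complex.sin_mul_I, Complex.ofReal_sinh]
  rw [hlim, Complex.im_ofReal_mul, Complex.I_im, mul_one] at h
  refine h.congr fun n => ?_
  have hprod : (π : ℂ) * ((x / π : ℝ) * Complex.I) *
      ∏ j ∈ Finset.range n, (1 - ((x / π : ℝ) * Complex.I) ^ 2 / ((j : ℂ) + 1) ^ 2) =
      ((x * ∏ j ∈ Finset.range n, (1 + x ^ 2 / (π ^ 2 * ((j : ℝ) + 1) ^ 2)) : ℝ) : ℂ) *
        Complex.I := by
    have hfactor : ∀ j : ℕ, (1 - ((x / π : ℝ) * Complex.I) ^ 2 / ((j : ℂ) + 1) ^ 2) =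
        1 + (x : ℂ) ^ 2 / (π ^ 2 * ((j : ℂ) + 1) ^ 2) := by
      intro j
      rw [mul_pow, Complex.I_sq, ← div_div]
      push_cast
      ring
    simp only [hfactor]
    push_cast
    field_simp
  simp only [Function.comp_apply]
  rw [hprod]
  rw [Complex.im_ofReal_mul, Complex.I_im, mul_one]

theorem multipliable_one_add_div_odd_sq (x : ℝ) :
    Multipliable (fun k : ℕ => 1 + 4 * x ^ 2 / (π ^ 2 * (2 * (k : ℝ) + 1) ^ 2)) := by
  apply Real.multipliable_one_add_of_summable
  have hodd : Summable fun k : ℕ => 1 / (((2 * k + 1 : ℕ) : ℝ)) ^ 2 :=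
    (Real.summable_one_div_nat_pow.mpr one_lt_two).comp_injective
      (i := fun k : ℕ => 2 * k + 1) fun a b hab => by simpa using hab
  refine (hodd.mul_left (4 * x ^ 2 / π ^ 2)).congr fun k => ?_
  push_cast
  rw [← div_div]
  ring

/-- Splitting a product over `range (2 * n)` into its even and odd factors. -/
theorem prod_one_add_div_sq_even_odd (x : ℝ) (n : ℕ) :
    ∏ j ∈ Finset.range (2 * n), (1 + (2 * x) ^ 2 / (π ^ 2 * ((j : ℝ) + 1) ^ 2)) =
      (∏ j ∈ Finset.range n, (1 + x ^ 2 / (π ^ 2 * ((j : ℝ) + 1) ^ 2))) *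
        ∏ k ∈ Finset.range n, (1 + 4 * x ^ 2 / (π ^ 2 * (2 * (k : ℝ) + 1) ^ 2)) := by
  induction n with
  | zero => simp
  | succ n ih =>
    have heven : (2 * x) ^ 2 / (π ^ 2 * (((2 * n + 1 : ℕ) : ℝ) + 1) ^ 2) =
        x ^ 2 / (π ^ 2 * ((n : ℝ) + 1) ^ 2) := by
      have := pi_ne_zero
      have : (n : ℝ) + 1 ≠ 0 := by positivity
      rw [show (((2 * n + 1 : ℕ) : ℝ) + 1) = 2 * ((n : ℝ) + 1) by push_cast; ring]
      field_simp
    rw [show 2 * (n + 1) = 2 * n + 1 + 1 by ring, Finset.prod_range_succ, Finset.prod_range_succ,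
      ih, Finset.prod_range_succ, Finset.prod_range_succ, heven]
    push_cast
    ring

theorem cosh_eq_tprod (x : ℝ) :
    Multipliable (fun k : ℕ => 1 + 4 * x ^ 2 / (π ^ 2 * (2 * (k : ℝ) + 1) ^ 2)) ∧
    ∏' k : ℕ, (1 + 4 * x ^ 2 / (π ^ 2 * (2 * (k : ℝ) + 1) ^ 2)) = Real.cosh x := by
  have hmult := multipliable_one_add_div_odd_sq x
  refine ⟨hmult, ?_⟩
  rcases eq_or_ne x 0 with rfl | hx
  · simp
  have hsplit := (((tendsto_euler_sinh_prod x).mul hmult.hasProd.tendsto_prod_nat).const_mul 2)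
  have hdouble := (tendsto_euler_sinh_prod (2 * x)).comp
    (Filter.tendsto_id.const_mul_atTop' (two_pos : (0 : ℕ) < 2))
  have heq := tendsto_nhds_unique hsplit (hdouble.congr fun n => by
    simp only [Function.comp_apply, id_eq]
    rw [prod_one_add_div_sq_even_odd]
    ring)
  rw [Real.sinh_two_mul, mul_assoc] at heq
  exact mul_left_cancel₀ (Real.sinh_ne_zero.mpr hx) (mul_left_cancel₀ two_ne_zero heq)
end

section
/- The function φ : [0,∞) → [0,∞) defined by φ(x) = (arsinh √x)² = log²(√x + √(1+x)) is a Bernstein function: φ(0) = 0, φ ≥ 0, φ is infinitely differentiable on (0,∞), and for every n ≥ 1 and every x > 0, (−1)^{n−1} · φ^{(n)}(x) ≥ 0 (i.e. the derivative of φ is completely monotone on (0,∞)). -/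
open Real

/-- The (sign-normalised) `n`-th derivative of `x ↦ ∫ t in 0..1, 1 / (1 + x (1 - t²))`. -/
noncomputable def stieltjesIntegral (n : ℕ) (x : ℝ) : ℝ :=
  ∫ t in (0 : ℝ)..1, (n.factorial : ℝ) * (1 - t ^ 2) ^ n / (1 + x * (1 - t ^ 2)) ^ (n + 1)

theorem one_sub_sq_nonneg_of_mem_uIoc {t : ℝ} (ht : t ∈ Set.uIoc (0 : ℝ) 1) :
    0 ≤ 1 - t ^ 2 := by
  rw [Set.uIoc_of_le zero_le_one] at ht
  nlinarith [ht.1, ht.2]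

theorem continuousOn_stieltjesIntegrand (n : ℕ) {x : ℝ} (hx : 0 < x) :
    ContinuousOn
      (fun t : ℝ => (n.factorial : ℝ) * (1 - t ^ 2) ^ n / (1 + x * (1 - t ^ 2)) ^ (n + 1))
      (Set.uIcc 0 1) := by
  refine ContinuousOn.div (by fun_prop) (by fun_prop) fun t ht => ?_
  rw [Set.uIcc_of_le zero_le_one] at ht
  have h : 0 ≤ 1 - t ^ 2 := by nlinarith [ht.1, ht.2]
  positivity

theorem stieltjesIntegral_nonneg (n : ℕ) {x : ℝ} (hx : 0 < x) : 0 ≤ stieltjesIntegral n x := by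
  refine intervalIntegral.integral_nonneg zero_le_one fun t ht => ?_
  have h : 0 ≤ 1 - t ^ 2 := by nlinarith [ht.1, ht.2]
  positivity

theorem hasDerivAt_stieltjesIntegral (n : ℕ) {x : ℝ} (hx : 0 < x) :
    HasDerivAt (stieltjesIntegral n) (-stieltjesIntegral (n + 1) x) x := by
  have integrable (k : ℕ) {y : ℝ} (hy : 0 < y) :=
    (continuousOn_stieltjesIntegrand k hy).intervalIntegrable (μ := MeasureTheory.volume)
  have key := (intervalIntegral.hasDerivAt_integral_of_dominated_loc_of_deriv_le
    (μ := MeasureTheory.volume) (a := 0) (b := 1) (x₀ := x) (s := Set.Ioi 0)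
    (F := fun y t => (n.factorial : ℝ) * (1 - t ^ 2) ^ n / (1 + y * (1 - t ^ 2)) ^ (n + 1))
    (F' := fun y t => -(((n + 1).factorial : ℝ) * (1 - t ^ 2) ^ (n + 1) /
      (1 + y * (1 - t ^ 2)) ^ (n + 1 + 1)))
    (bound := fun _ => ((n + 1).factorial : ℝ))
    (Ioi_mem_nhds hx)
    (Filter.eventually_of_mem (Ioi_mem_nhds hx) fun y hy =>
      (integrable n hy).aestronglyMeasurable_restrict_uIoc)
    (integrable n hx) (integrable (n + 1) hx).aestronglyMeasurable_restrict_uIoc.neg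
    (Filter.Eventually.of_forall fun t ht y hy => ?_)
    intervalIntegrable_const
    (Filter.Eventually.of_forall fun t ht y hy => ?_)).2
  · rw [intervalIntegral.integral_neg] at key
    exact key
  · have h := one_sub_sq_nonneg_of_mem_uIoc ht
    have hy : 0 < y := hy
    have h1 : 1 - t ^ 2 ≤ 1 := by nlinarith [sq_nonneg t]
    have h2 : (1 - t ^ 2) ^ (n + 1) ≤ 1 := pow_le_one₀ h h1
    have h3 : 1 ≤ (1 + y * (1 - t ^ 2)) ^ (n + 1 + 1) :=
      one_le_pow₀ (le_add_of_nonneg_right (by positivity))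
    rw [norm_neg, Real.norm_of_nonneg (by positivity)]
    refine div_le_of_le_mul₀ (by positivity) (by positivity) ?_
    gcongr
    exact h2.trans h3
  · have h := one_sub_sq_nonneg_of_mem_uIoc ht
    have hy : 0 < y := hy
    have hpos : 0 < 1 + y * (1 - t ^ 2) := by positivity
    have hd : HasDerivAt (fun z : ℝ => 1 + z * (1 - t ^ 2)) (1 - t ^ 2) y := by
      simpa using ((hasDerivAt_id y).mul_const (1 - t ^ 2)).const_add 1
    refine ((hasDerivAt_const y ((n.factorial : ℝ) * (1 - t ^ 2) ^ n)).fun_div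
      (hd.fun_pow (n + 1)) (by positivity)).congr_deriv ?_
    rw [Nat.factorial_succ]
    push_cast
    field_simp
    simp
    ring

theorem stieltjesIntegral_zero {x : ℝ} (hx : 0 < x) :
    stieltjesIntegral 0 x = arsinh (√x) / (√x * √(1 + x)) := by
  have hs : 0 < √x := by positivity
  have hc : 0 < √(1 + x) := by positivity
  have hs2 : √x ^ 2 = x := sq_sqrt hx.le
  have hc2 : √(1 + x) ^ 2 = 1 + x := sq_sqrt (by positivity)
  have harsinh : arsinh (√x) = log (√(1 + x) + √x) := by
    rw [arsinh, hs2, add_comm]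
  set s := √x
  set c := √(1 + x)
  have hsc : s < c := by nlinarith
  have hderiv : ∀ t ∈ Set.uIcc (0 : ℝ) 1,
      HasDerivAt (fun t => (log (c + s * t) - log (c - s * t)) / (2 * (s * c)))
        ((Nat.factorial 0 : ℝ) * (1 - t ^ 2) ^ 0 / (1 + x * (1 - t ^ 2)) ^ (0 + 1)) t := by
    intro t ht
    rw [Set.uIcc_of_le zero_le_one] at ht
    have h1 : 0 < c + s * t := by nlinarith [ht.1]
    have h2 : 0 < c - s * t := by nlinarith [ht.2]
    have hst : HasDerivAt (fun t => s * t) s t := by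
      simpa using (hasDerivAt_id t).const_mul s
    have h3 : 1 + x * (1 - t ^ 2) = (c + s * t) * (c - s * t) := by
      linear_combination t ^ 2 * hs2 - hc2
    refine ((((hst.const_add c).log h1.ne').sub ((hst.const_sub c).log h2.ne')).div_const
      (2 * (s * c))).congr_deriv ?_
    rw [h3]
    field_simp
    simp
    ring
  rw [stieltjesIntegral, intervalIntegral.integral_eq_sub_of_hasDerivAt hderiv
    (continuousOn_stieltjesIntegrand 0 hx).intervalIntegrable, harsinh]
  have hinv : c - s = (c + s)⁻¹ :=
    eq_inv_of_mul_eq_one_left (by linear_combination hc2 - hs2)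
  simp only [mul_one, mul_zero, add_zero, sub_zero, sub_self, zero_div, hinv, log_inv]
  field_simp
  ring

theorem hasDerivAt_arsinh_sqrt_sq {x : ℝ} (hx : 0 < x) :
    HasDerivAt (fun y => arsinh (√y) ^ 2) (stieltjesIntegral 0 x) x := by
  rw [stieltjesIntegral_zero hx]
  refine (((hasDerivAt_sqrt hx.ne').arsinh).fun_pow 2).congr_deriv ?_
  rw [sq_sqrt hx.le]
  have hs : 0 < √x := by positivity
  have hc : 0 < √(1 + x) := by positivity
  simp only [smul_eq_mul]
  field_simp
  simp

theorem iteratedDeriv_succ_arsinh_sqrt_sq (n : ℕ) {x : ℝ} (hx : 0 < x) :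
    iteratedDeriv (n + 1) (fun y => arsinh (√y) ^ 2) x = (-1) ^ n * stieltjesIntegral n x := by
  induction n generalizing x with
  | zero => simpa using (hasDerivAt_arsinh_sqrt_sq hx).deriv
  | succ n ih =>
    have heq : iteratedDeriv (n + 1) (fun y => arsinh (√y) ^ 2) =ᶠ[nhds x]
        fun y => (-1) ^ n * stieltjesIntegral n y :=
      Filter.eventually_of_mem (Ioi_mem_nhds hx) fun y hy => ih hy
    rw [iteratedDeriv_succ, heq.deriv_eq,
      ((hasDerivAt_stieltjesIntegral n hx).const_mul _).deriv]
    ring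

theorem arsinh_sq_is_bernstein
    (φ : ℝ → ℝ) (hφ : ∀ x : ℝ, φ x = (Real.arsinh (Real.sqrt x)) ^ 2) :
    φ 0 = 0 ∧
    (∀ x : ℝ, 0 ≤ x → 0 ≤ φ x) ∧
    ContDiffOn ℝ (⊤ : ℕ∞) φ (Set.Ioi 0) ∧
    (∀ n : ℕ, 1 ≤ n → ∀ x : ℝ, 0 < x →
      0 ≤ (-1 : ℝ) ^ (n - 1) * iteratedDeriv n φ x) := by
  obtain rfl : φ = fun x => arsinh (√x) ^ 2 := funext hφ
  refine ⟨by simp, fun x _ => sq_nonneg _, fun x hx => ?_, fun n hn x hx => ?_⟩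
  · exact ((contDiffAt_sqrt (ne_of_gt hx)).arsinh.pow 2).contDiffWithinAt
  · obtain ⟨m, rfl⟩ := Nat.exists_eq_add_of_le' hn
    rw [Nat.add_sub_cancel, iteratedDeriv_succ_arsinh_sqrt_sq m hx, ← mul_assoc, ← mul_pow]
    simpa using stieltjesIntegral_nonneg m hx
end

section
/- For every real m > 0, the function ψ(x) := (1/2)·log(1+x) + log( cosh( m · arsinh(√x) ) ) is a Bernstein function: ψ(0) = 0, ψ ≥ 0 on [0,∞), ψ is smooth on (0,∞), and (−1)^{n−1} ψ^{(n)}(x) ≥ 0 for all n ≥ 1 and x > 0. Consequently the distribution whose Laplace transform is exp(−ψ) (the law of the size-biased inverse exponential functional X_{2,c} with m = π/(2c)) is infinitely divisible. -/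
open Real MeasureTheory

open Filter Topology unitInterval

/-- `F` is, on `(0, ∞)`, the Laplace transform of a probability measure on `[0, ∞]`, written in
the variable `r = exp (-y)` of the compact interval `[0, 1]`. -/
def IsLaplaceTransform (F : ℝ → ℝ) : Prop :=
  ∃ ν : Measure I, IsProbabilityMeasure ν ∧ ∀ x : ℝ, 0 < x → ∫ r : I, (r : ℝ) ^ x ∂ν = F x

/-- All functions `exp (-c f)`, `c > 0`, are Laplace transforms of probability measures on
`[0, ∞]`. -/
def IsLaplaceExponent (f : ℝ → ℝ) : Prop :=
  ∀ c : ℝ, 0 < c → IsLaplaceTransform fun x => exp (-c * f x)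

theorem continuous_coe_rpow {x : ℝ} (hx : 0 < x) : Continuous fun r : I => (r : ℝ) ^ x :=
  continuous_subtype_val.rpow_const fun _ => Or.inr hx.le

theorem Continuous.integrable_unitInterval {f : I → ℝ} (hf : Continuous f) (ν : Measure I)
    [IsFiniteMeasure ν] : Integrable f ν :=
  (BoundedContinuousFunction.mkOfCompact ⟨f, hf⟩).integrable ν

namespace IsLaplaceTransform

variable {F G : ℝ → ℝ}

theorem congr (hF : IsLaplaceTransform F) (h : ∀ x, 0 < x → F x = G x) :
    IsLaplaceTransform G := by
  obtain ⟨ν, hprob, hν⟩ := hF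
  exact ⟨ν, hprob, fun x hx => (hν x hx).trans (h x hx)⟩

theorem nonneg (hF : IsLaplaceTransform F) {x : ℝ} (hx : 0 < x) : 0 ≤ F x := by
  obtain ⟨ν, hprob, hν⟩ := hF
  rw [← hν x hx]
  exact integral_nonneg fun r => rpow_nonneg r.2.1 x

theorem le_one (hF : IsLaplaceTransform F) {x : ℝ} (hx : 0 < x) : F x ≤ 1 := by
  obtain ⟨ν, hprob, hν⟩ := hF
  rw [← hν x hx]
  calc ∫ r : I, (r : ℝ) ^ x ∂ν ≤ ∫ _ : I, (1 : ℝ) ∂ν :=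
        integral_mono ((continuous_coe_rpow hx).integrable_unitInterval _)
          (integrable_const 1) fun r => rpow_le_one r.2.1 r.2.2 hx.le
    _ = 1 := by simp

theorem exp_neg_mul {c : ℝ} (hc : 0 < c) : IsLaplaceTransform fun x => exp (-c * x) := by
  refine ⟨Measure.dirac ⟨exp (-c), (exp_pos _).le, exp_le_one_iff.2 (by linarith)⟩,
    inferInstance, fun x _ => ?_⟩
  exact (integral_dirac _ _).trans (exp_mul _ _).symm

theorem one : IsLaplaceTransform fun _ => 1 :=
  ⟨Measure.dirac 1, inferInstance, fun x _ => by simp⟩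

theorem mul (hF : IsLaplaceTransform F) (hG : IsLaplaceTransform G) :
    IsLaplaceTransform fun x => F x * G x := by
  obtain ⟨ν, hprob, hν⟩ := hF
  obtain ⟨κ, hprob', hκ⟩ := hG
  have hm : Measurable fun p : I × I => p.1 * p.2 := by fun_prop
  refine ⟨(ν.prod κ).map fun p => p.1 * p.2,
    Measure.isProbabilityMeasure_map hm.aemeasurable, fun x hx => ?_⟩
  beta_reduce
  rw [← hν x hx, ← hκ x hx, ← integral_prod_mul,
    integral_map hm.aemeasurable (continuous_coe_rpow hx).aestronglyMeasurable]
  refine integral_congr_ae (ae_of_all _ fun p => ?_)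
  simp [mul_rpow p.1.2.1 p.2.2.1]

theorem pow (hF : IsLaplaceTransform F) (n : ℕ) : IsLaplaceTransform fun x => F x ^ n := by
  induction n with
  | zero => simpa using one
  | succ n ih => simpa only [pow_succ] using ih.mul hF

theorem convexCombination (hF : IsLaplaceTransform F) (hG : IsLaplaceTransform G) {a b : ℝ}
    (ha : 0 ≤ a) (hb : 0 ≤ b) (hab : a + b = 1) :
    IsLaplaceTransform fun x => a * F x + b * G x := by
  obtain ⟨ν, hprob, hν⟩ := hF
  obtain ⟨κ, hprob', hκ⟩ := hG
  refine ⟨ENNReal.ofReal a • ν + ENNReal.ofReal b • κ, ⟨?_⟩, fun x hx => ?_⟩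
  · simp [← ENNReal.ofReal_add ha hb, hab]
  · have hc := continuous_coe_rpow hx
    rw [integral_add_measure
      ((hc.integrable_unitInterval _).smul_measure ENNReal.ofReal_ne_top)
      ((hc.integrable_unitInterval _).smul_measure ENNReal.ofReal_ne_top),
      integral_smul_measure, integral_smul_measure, hν x hx, hκ x hx,
      ENNReal.toReal_ofReal ha, ENNReal.toReal_ofReal hb, smul_eq_mul, smul_eq_mul]

theorem of_tendsto {F : ℕ → ℝ → ℝ} (hF : ∀ k, IsLaplaceTransform (F k))
    (h : ∀ x, 0 < x → Tendsto (fun k => F k x) atTop (𝓝 (G x))) : IsLaplaceTransform G := by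
  choose ν hprob hν using hF
  let ρ : ℕ → ProbabilityMeasure I := fun k => ⟨ν k, hprob k⟩
  obtain ⟨κ, -, hκ⟩ := isCompact_univ.ultrafilter_le_nhds ((hyperfilter ℕ).map ρ) (by simp)
  refine ⟨κ, inferInstance, fun x hx => ?_⟩
  have hlim : Tendsto ρ (hyperfilter ℕ) (𝓝 κ) := hκ
  have h₁ := (ProbabilityMeasure.tendsto_iff_forall_integral_tendsto.1 hlim)
    (BoundedContinuousFunction.mkOfCompact ⟨_, continuous_coe_rpow hx⟩)
  simp only [BoundedContinuousFunction.mkOfCompact_apply, ContinuousMap.coe_mk,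
    ρ, ProbabilityMeasure.coe_mk, hν _ x hx] at h₁
  exact tendsto_nhds_unique h₁ ((h x hx).mono_left Nat.hyperfilter_le_atTop)

/-- The compound Poisson construction. -/
theorem isLaplaceExponent_one_sub (hF : IsLaplaceTransform F) :
    IsLaplaceExponent fun x => 1 - F x := by
  intro c hc
  have hk (k : ℕ) : IsLaplaceTransform fun x =>
      (1 + -c * (1 - F x) / ((k + (⌈c⌉₊ + 1) : ℕ) : ℝ)) ^ (k + (⌈c⌉₊ + 1)) := by
    set N : ℕ := k + (⌈c⌉₊ + 1) with hN
    have hNpos : (0 : ℝ) < N := by positivity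
    have hcN : c ≤ N := by
      have := Nat.le_ceil c
      rw [hN]; push_cast; linarith [k.cast_nonneg (α := ℝ)]
    have hle : c / N ≤ 1 := (div_le_one hNpos).2 hcN
    refine ((one.convexCombination hF (sub_nonneg.2 hle) (div_nonneg hc.le hNpos.le)
      (sub_add_cancel 1 (c / N))).pow N).congr fun x _ => ?_
    congr 1
    ring
  refine of_tendsto hk fun x _ => ?_
  exact (tendsto_one_add_div_pow_exp (-c * (1 - F x))).comp (tendsto_add_atTop_nat _)

end IsLaplaceTransform

theorem tendsto_div_of_hasDerivAt_zero {g : ℝ → ℝ} {a : ℝ} (hg : HasDerivAt g a 0) (h0 : g 0 = 0)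
    {u : ℕ → ℝ} (hu : Tendsto u atTop (𝓝 0)) (hu' : ∀ k, 0 < u k) :
    Tendsto (fun k => g (u k) / u k) atTop (𝓝 a) := by
  have := (hasDerivAt_iff_tendsto_slope_zero.1 hg).comp
    (tendsto_nhdsWithin_iff.2 ⟨hu, Eventually.of_forall fun k => (hu' k).ne'⟩)
  refine this.congr fun k => ?_
  simp [h0, div_eq_inv_mul]

theorem tendsto_inv_two_pow : Tendsto (fun k : ℕ => ((2 : ℝ) ^ k)⁻¹) atTop (𝓝 0) :=
  (tendsto_pow_atTop_atTop_of_one_lt one_lt_two).inv_tendsto_atTop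

namespace IsLaplaceExponent

variable {f g : ℝ → ℝ}

theorem congr (hf : IsLaplaceExponent f) (h : ∀ x, 0 < x → f x = g x) : IsLaplaceExponent g :=
  fun c hc => (hf c hc).congr fun x hx => by rw [h x hx]

theorem nonneg (hf : IsLaplaceExponent f) {x : ℝ} (hx : 0 < x) : 0 ≤ f x := by
  simpa using (hf 1 one_pos).le_one hx

theorem id : IsLaplaceExponent fun x => x :=
  fun _ hc => .exp_neg_mul hc

theorem add (hf : IsLaplaceExponent f) (hg : IsLaplaceExponent g) :
    IsLaplaceExponent fun x => f x + g x :=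
  fun c hc => ((hf c hc).mul (hg c hc)).congr fun x _ => by rw [← exp_add]; ring_nf

theorem const_mul (hf : IsLaplaceExponent f) {a : ℝ} (ha : 0 < a) :
    IsLaplaceExponent fun x => a * f x :=
  fun c hc => (hf (c * a) (mul_pos hc ha)).congr fun x _ => by ring_nf

theorem of_tendsto {f : ℕ → ℝ → ℝ} (hf : ∀ k, IsLaplaceExponent (f k))
    (h : ∀ x, 0 < x → Tendsto (fun k => f k x) atTop (𝓝 (g x))) : IsLaplaceExponent g :=
  fun c hc => .of_tendsto (fun k => hf k c hc) fun x hx =>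
    (continuous_exp.tendsto _).comp ((h x hx).const_mul (-c))

/-- `V = 1 + δ - √(δ² + 1 - F)` is the fixed point of
`V ↦ (2 δ + F + V²) / (2 + 2 δ)`, which is a contraction of `[0, 1]`. -/
theorem sqrt_one_sub_add_sq {F : ℝ → ℝ} (hF : IsLaplaceTransform F) {δ : ℝ} (hδ : 0 < δ) :
    IsLaplaceExponent fun x => √(δ ^ 2 + 1 - F x) - δ := by
  let V : ℕ → ℝ → ℝ := fun k x => (fun v => (2 * δ + F x + v ^ 2) / (2 + 2 * δ))^[k] 1
  have hV (k : ℕ) : IsLaplaceTransform (V k) := by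
    induction k with
    | zero => exact .one
    | succ k ih =>
      have h₁ := hF.convexCombination (ih.pow 2) (a := 1 / 2) (b := 1 / 2) (by norm_num)
        (by norm_num) (by norm_num)
      refine (IsLaplaceTransform.one.convexCombination h₁ (a := δ / (1 + δ)) (b := 1 / (1 + δ))
        (by positivity) (by positivity) (by field_simp; ring)).congr fun x _ => ?_
      simp only [V, Function.iterate_succ_apply']
      field_simp
      ring
  have hlim : IsLaplaceTransform fun x => 1 + δ - √(δ ^ 2 + 1 - F x) := by
    refine .of_tendsto hV fun x hx => ?_
    have h0 := hF.nonneg hx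
    have h1 := hF.le_one hx
    set s := √(δ ^ 2 + 1 - F x) with hs
    have hs2 : s ^ 2 = δ ^ 2 + 1 - F x := sq_sqrt (by nlinarith)
    have hs0 : 0 ≤ s := sqrt_nonneg _
    have hδs : δ ≤ s := by nlinarith
    have hsδ : s ≤ 1 + δ := by nlinarith
    set q : ℝ := 1 / (1 + δ) with hq
    have hq0 : 0 < q := by positivity
    have hq1 : q < 1 := by rw [hq, div_lt_one (by positivity)]; linarith
    have hbound (k : ℕ) : |V k x - (1 + δ - s)| ≤ q ^ k := by
      induction k with
      | zero =>
        simp only [V, Function.iterate_zero, _root_.id, pow_zero]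
        rw [abs_le]
        constructor <;> linarith
      | succ k ih =>
        have hv0 := (hV k).nonneg hx
        have hv1 := (hV k).le_one hx
        have heq : V (k + 1) x - (1 + δ - s) =
            (V k x - (1 + δ - s)) * (q * ((V k x + (1 + δ - s)) / 2)) := by
          have : V (k + 1) x = (2 * δ + F x + V k x ^ 2) / (2 + 2 * δ) := by
            simp only [V, Function.iterate_succ_apply']
          rw [this, hq]
          field_simp
          linear_combination hs2
        rw [heq, abs_mul, pow_succ]
        refine mul_le_mul ih ?_ (abs_nonneg _) (by positivity)
        rw [abs_mul, abs_of_pos hq0, abs_of_nonneg (by linarith)]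
        exact mul_le_of_le_one_right hq0.le (by linarith)
    exact tendsto_iff_norm_sub_tendsto_zero.2 (squeeze_zero (fun _ => norm_nonneg _) hbound
      (tendsto_pow_atTop_nhds_zero_of_lt_one hq0.le hq1))
  exact hlim.isLaplaceExponent_one_sub.congr fun x _ => by ring

theorem sqrt_one_add_sub_one (hf : IsLaplaceExponent f) :
    IsLaplaceExponent fun x => √(1 + f x) - 1 := by
  have hk (k : ℕ) : IsLaplaceExponent fun x =>
      √(1 + (1 - exp (-(((2 : ℝ) ^ k)⁻¹ ^ 2 * f x))) / ((2 : ℝ) ^ k)⁻¹ ^ 2) - 1 := by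
    set δ : ℝ := ((2 : ℝ) ^ k)⁻¹
    have hδ : 0 < δ := by positivity
    refine ((sqrt_one_sub_add_sq (hf _ (pow_pos hδ 2)) hδ).const_mul (inv_pos.2 hδ)).congr
      fun x _ => ?_
    have : δ ^ 2 + 1 - exp (-δ ^ 2 * f x) = δ ^ 2 * (1 + (1 - exp (-(δ ^ 2 * f x))) / δ ^ 2) := by
      rw [neg_mul]; field_simp; ring
    rw [this, sqrt_mul (by positivity), sqrt_sq hδ.le]
    field_simp
  refine of_tendsto hk fun x _ => ?_
  have hd : HasDerivAt (fun s : ℝ => 1 - exp (-(s * f x))) (f x) 0 := by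
    simpa using (((hasDerivAt_id (0 : ℝ)).mul_const (f x)).neg.exp).const_sub 1
  have := tendsto_div_of_hasDerivAt_zero hd (by simp)
    (u := fun k => ((2 : ℝ) ^ k)⁻¹ ^ 2)
    (by simpa using tendsto_inv_two_pow.pow 2) (fun k => by positivity)
  exact ((continuous_sqrt.tendsto _).comp (this.const_add 1)).sub_const 1

theorem log_one_add (hf : IsLaplaceExponent f) : IsLaplaceExponent fun x => log (1 + f x) := by
  have hk (k : ℕ) : IsLaplaceExponent fun x => exp (((2 : ℝ) ^ k)⁻¹ * log (1 + f x)) - 1 := by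
    induction k with
    | zero =>
      refine hf.congr fun x hx => ?_
      simp [exp_log (by linarith [hf.nonneg hx] : 0 < 1 + f x)]
    | succ k ih =>
      refine ih.sqrt_one_add_sub_one.congr fun x _ => ?_
      rw [add_sub_cancel, ← exp_half]
      congr 2
      field_simp
      ring
  refine of_tendsto (fun k => (hk k).const_mul (a := 2 ^ k) (by positivity)) fun x _ => ?_
  have hd : HasDerivAt (fun s : ℝ => exp (s * log (1 + f x)) - 1) (log (1 + f x)) 0 := by
    simpa using (((hasDerivAt_id (0 : ℝ)).mul_const (log (1 + f x))).exp).sub_const 1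
  refine (tendsto_div_of_hasDerivAt_zero hd (by simp) tendsto_inv_two_pow
    (fun k => by positivity)).congr fun k => ?_
  rw [div_inv_eq_mul, mul_comm]

theorem arsinh_sqrt_sq : IsLaplaceExponent fun x => arsinh (√x) ^ 2 := by
  have hk (k : ℕ) : IsLaplaceExponent fun x => sinh (((2 : ℝ) ^ k)⁻¹ * arsinh (√x)) ^ 2 := by
    induction k with
    | zero => exact id.congr fun x hx => by simp [sq_sqrt hx.le]
    | succ k ih =>
      refine (ih.sqrt_one_add_sub_one.const_mul (a := 1 / 2) (by norm_num)).congr fun x _ => ?_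
      have h2 : ((2 : ℝ) ^ k)⁻¹ * arsinh (√x) = 2 * (((2 : ℝ) ^ (k + 1))⁻¹ * arsinh (√x)) := by
        field_simp
        ring
      rw [h2, add_comm, ← cosh_sq, sqrt_sq (cosh_pos _).le, cosh_two_mul, cosh_sq]
      ring
  refine of_tendsto (fun k => (hk k).const_mul (a := (2 ^ k) ^ 2) (by positivity)) fun x _ => ?_
  have hd : HasDerivAt (fun s : ℝ => sinh (s * arsinh (√x))) (arsinh (√x)) 0 := by
    simpa using ((hasDerivAt_id (0 : ℝ)).mul_const (arsinh (√x))).sinh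
  refine ((tendsto_div_of_hasDerivAt_zero hd (by simp) tendsto_inv_two_pow
    (fun k => by positivity)).pow 2).congr fun k => ?_
  rw [div_inv_eq_mul]
  ring

/-- The map `sinh² s ↦ sinh² (2 s)` has only nonpositive roots, also after adding `b ∈ (0, 1]`. -/
theorem log_one_add_iterate_div (hf : IsLaplaceExponent f) (k : ℕ) :
    ∀ b : ℝ, 0 < b → b ≤ 1 →
      IsLaplaceExponent fun x => log (1 + (fun y => 4 * y * (1 + y))^[k] (f x) / b) := by
  have hnonneg (k : ℕ) (y : ℝ) (hy : 0 ≤ y) : 0 ≤ (fun y : ℝ => 4 * y * (1 + y))^[k] y := by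
    induction k with
    | zero => simpa
    | succ k ih => rw [Function.iterate_succ_apply']; positivity
  induction k with
  | zero =>
    intro b hb _
    exact (hf.const_mul (inv_pos.2 hb)).log_one_add.congr fun x _ => by
      simp [div_eq_inv_mul]
  | succ k ih =>
    intro b hb hb1
    set s := √(1 - b)
    have hs2 : s ^ 2 = 1 - b := sq_sqrt (by linarith)
    have hs0 : 0 ≤ s := sqrt_nonneg _
    have hs1 : s < 1 := by nlinarith
    refine ((ih ((1 + s) / 2) (by linarith) (by linarith)).add
      (ih ((1 - s) / 2) (by linarith) (by linarith))).congr fun x hx => ?_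
    rw [Function.iterate_succ_apply']
    set Y := (fun y : ℝ => 4 * y * (1 + y))^[k] (f x)
    have hY : 0 ≤ Y := hnonneg k _ (hf.nonneg hx)
    have h1 : 0 < 1 + s := by linarith
    have h2 : 0 < 1 - s := by linarith
    rw [← log_mul (by positivity) (by positivity)]
    congr 1
    have hb' : b = (1 + s) * (1 - s) := by linarith
    rw [hb']
    field_simp
    ring

theorem log_cosh_mul_arsinh_sqrt {m : ℝ} (hm : 0 < m) :
    IsLaplaceExponent fun x => log (cosh (m * arsinh (√x))) := by
  have hiter (k : ℕ) (s : ℝ) :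
      (fun y : ℝ => 4 * y * (1 + y))^[k] (sinh s ^ 2) = sinh (2 ^ k * s) ^ 2 := by
    induction k with
    | zero => simp
    | succ k ih =>
      rw [Function.iterate_succ_apply', ih, pow_succ' 2 k, mul_assoc 2, sinh_two_mul, mul_pow, cosh_sq]
      ring
  have hk (k : ℕ) : IsLaplaceExponent fun x =>
      log (cosh (2 * (2 ^ k * arsinh (((2 : ℝ) ^ k)⁻¹ * (m / 2 * arsinh (√x)))))) := by
    refine ((arsinh_sqrt_sq.const_mul (a := (((2 : ℝ) ^ k)⁻¹ * (m / 2)) ^ 2)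
      (by positivity)).log_one_add_iterate_div k (1 / 2) (by norm_num) (by norm_num)).congr
      fun x _ => ?_
    have : (((2 : ℝ) ^ k)⁻¹ * (m / 2)) ^ 2 * arsinh (√x) ^ 2 =
        sinh (arsinh (((2 : ℝ) ^ k)⁻¹ * (m / 2 * arsinh (√x)))) ^ 2 := by
      rw [sinh_arsinh]
      ring
    rw [this, hiter, cosh_two_mul, cosh_sq]
    congr 1
    ring
  refine of_tendsto hk fun x _ => ?_
  have hd : HasDerivAt (fun s : ℝ => arsinh (s * (m / 2 * arsinh (√x))))
      (m / 2 * arsinh (√x)) 0 := by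
    simpa using ((hasDerivAt_id (0 : ℝ)).mul_const (m / 2 * arsinh (√x))).arsinh
  have h := (tendsto_div_of_hasDerivAt_zero hd (by simp) tendsto_inv_two_pow
    (fun k => by positivity)).const_mul 2
  rw [show 2 * (m / 2 * arsinh (√x)) = m * arsinh (√x) by ring] at h
  refine ((continuous_cosh.tendsto _).comp h).log (cosh_pos _).ne' |>.congr fun k => ?_
  simp only [Function.comp_apply, div_inv_eq_mul]
  congr 3
  ring

end IsLaplaceExponent

/-- The alternating differences of order `n` are nonnegative on `(0, ∞)`. -/
def AlternatingDifferences : ℕ → (ℝ → ℝ) → Prop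
  | 0, g => ∀ x, 0 < x → 0 ≤ g x
  | n + 1, g => ∀ h, 0 < h → AlternatingDifferences n fun x => g x - g (x + h)

namespace AlternatingDifferences

theorem congr {n : ℕ} : ∀ {g g' : ℝ → ℝ}, AlternatingDifferences n g →
    (∀ x, 0 < x → g x = g' x) → AlternatingDifferences n g' := by
  induction n with
  | zero => exact fun hg h x hx => (hg x hx).trans_eq (h x hx)
  | succ n ih =>
    exact fun hg h t ht => ih (hg t ht) fun x hx => by rw [h x hx, h (x + t) (by linarith)]

theorem const_mul {a : ℝ} (ha : 0 ≤ a) {n : ℕ} : ∀ {g : ℝ → ℝ}, AlternatingDifferences n g →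
    AlternatingDifferences n fun x => a * g x := by
  induction n with
  | zero => exact fun hg x hx => mul_nonneg ha (hg x hx)
  | succ n ih => exact fun hg t ht => (ih (hg t ht)).congr fun x _ => by ring

theorem of_tendsto {n : ℕ} : ∀ {g : ℕ → ℝ → ℝ} {l : ℝ → ℝ},
    (∀ k, AlternatingDifferences n (g k)) →
    (∀ x, 0 < x → Tendsto (fun k => g k x) atTop (𝓝 (l x))) → AlternatingDifferences n l := by
  induction n with
  | zero => exact fun hg h x hx => ge_of_tendsto' (h x hx) fun k => hg k x hx
  | succ n ih =>
    exact fun hg h t ht => ih (fun k => hg k t ht) fun x hx =>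
      (h x hx).sub (h (x + t) (by linarith))

theorem integral_rpow_mul (ν : Measure I) [IsFiniteMeasure ν] (n : ℕ) :
    ∀ w : I → ℝ, Continuous w → (∀ r, 0 ≤ w r) →
      AlternatingDifferences n fun x => ∫ r : I, (r : ℝ) ^ x * w r ∂ν := by
  induction n with
  | zero =>
    exact fun w _ hw x _ => integral_nonneg fun r => mul_nonneg (rpow_nonneg r.2.1 x) (hw r)
  | succ n ih =>
    intro w hc hw t ht
    refine (ih (fun r => (1 - (r : ℝ) ^ t) * w r)
      ((continuous_const.sub (continuous_coe_rpow ht)).mul hc) fun r =>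
        mul_nonneg (sub_nonneg.2 (rpow_le_one r.2.1 r.2.2 ht.le)) (hw r)).congr fun x hx => ?_
    have hxt : 0 < x + t := by linarith
    have hint {z : ℝ} (hz : 0 < z) : Integrable (fun r : I => (r : ℝ) ^ z * w r) ν :=
      ((continuous_coe_rpow hz).mul hc).integrable_unitInterval ν
    beta_reduce
    rw [← integral_sub (hint hx) (hint hxt)]
    refine integral_congr_ae (ae_of_all _ fun r => ?_)
    simp only [rpow_add_of_nonneg r.2.1 hx.le ht.le]
    ring

theorem neg_deriv {n : ℕ} {g : ℝ → ℝ} (hg : AlternatingDifferences (n + 1) g)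
    (hd : ∀ x, 0 < x → DifferentiableAt ℝ g x) :
    AlternatingDifferences n fun x => -deriv g x := by
  refine of_tendsto (g := fun k x => 2 ^ k * (g x - g (x + ((2 : ℝ) ^ k)⁻¹)))
    (fun k => (hg _ (by positivity)).const_mul (by positivity)) fun x hx => ?_
  have h : HasDerivAt (fun s => g x - g (x + s)) (-deriv g x) 0 := by
    have h₁ : HasDerivAt g (deriv g x) (x + 0) := by simpa using (hd x hx).hasDerivAt
    exact (h₁.comp_const_add x 0).const_sub (g x)
  refine (tendsto_div_of_hasDerivAt_zero h (by simp) tendsto_inv_two_pow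
    (fun k => by positivity)).congr fun k => ?_
  rw [div_inv_eq_mul, mul_comm]

theorem iteratedDeriv_nonneg {n : ℕ} : ∀ {g : ℝ → ℝ}, AlternatingDifferences n g →
    ContDiffOn ℝ (⊤ : ℕ∞) g (Set.Ioi 0) →
    ∀ x, 0 < x → 0 ≤ (-1 : ℝ) ^ n * iteratedDeriv n g x := by
  induction n with
  | zero => exact fun hg _ x hx => by simpa using hg x hx
  | succ n ih =>
    intro g hg hc x hx
    have h := ih (hg.neg_deriv fun y hy =>
      (hc.contDiffAt (Ioi_mem_nhds hy)).differentiableAt (by simp))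
      (hc.deriv_of_isOpen isOpen_Ioi (by simp)).neg x hx
    rw [iteratedDeriv_fun_neg] at h
    rw [iteratedDeriv_succ', pow_succ]
    linarith

end AlternatingDifferences

theorem IsLaplaceTransform.alternatingDifferences {F : ℝ → ℝ} (hF : IsLaplaceTransform F) (n : ℕ) :
    AlternatingDifferences n F := by
  obtain ⟨ν, hprob, hν⟩ := hF
  exact (AlternatingDifferences.integral_rpow_mul ν n (fun _ => 1) continuous_const
    fun _ => zero_le_one).congr fun x hx => by simpa using hν x hx

theorem IsLaplaceExponent.alternatingDifferences_neg {f : ℝ → ℝ} (hf : IsLaplaceExponent f)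
    (n : ℕ) : AlternatingDifferences (n + 1) fun x => -f x := by
  refine .of_tendsto (g := fun k x => 2 ^ k * (exp (-((2 : ℝ) ^ k)⁻¹ * f x) - 1))
    (fun k => .const_mul (by positivity) fun t ht => ?_) fun x _ => ?_
  · exact ((hf ((2 : ℝ) ^ k)⁻¹ (by positivity)).alternatingDifferences (n + 1) t ht).congr
      fun x _ => by ring
  · have hd : HasDerivAt (fun s : ℝ => exp (-s * f x) - 1) (-f x) 0 := by
      simpa using (((hasDerivAt_id (0 : ℝ)).neg.mul_const (f x)).exp).sub_const 1
    refine (tendsto_div_of_hasDerivAt_zero hd (by simp) tendsto_inv_two_pow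
      (fun k => by positivity)).congr fun k => ?_
    rw [div_inv_eq_mul, mul_comm]

/-- Derivatives of Laplace exponents alternate in sign. -/
theorem IsLaplaceExponent.iteratedDeriv_nonneg {f : ℝ → ℝ} (hf : IsLaplaceExponent f)
    (hc : ContDiffOn ℝ (⊤ : ℕ∞) f (Set.Ioi 0)) {n : ℕ} (hn : 1 ≤ n) {x : ℝ} (hx : 0 < x) :
    0 ≤ (-1 : ℝ) ^ (n - 1) * iteratedDeriv n f x := by
  obtain ⟨n, rfl⟩ := Nat.exists_eq_add_of_le' hn
  have h := (hf.alternatingDifferences_neg n).iteratedDeriv_nonneg hc.neg x hx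
  rw [iteratedDeriv_fun_neg, pow_succ] at h
  rw [Nat.add_sub_cancel]
  linarith

/-- A probability measure on `[0, 1]` is determined by its moments. -/
theorem MeasureTheory.Measure.ext_of_integral_pow_unitInterval {ν κ : Measure I}
    [IsProbabilityMeasure ν] [IsProbabilityMeasure κ]
    (h : ∀ n : ℕ, ∫ r : I, (r : ℝ) ^ n ∂ν = ∫ r : I, (r : ℝ) ^ n ∂κ) : ν = κ := by
  have hint (ρ : Measure I) [IsProbabilityMeasure ρ] (q : Polynomial ℝ) :
      Integrable (fun r : I => q.eval (r : ℝ)) ρ :=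
    (q.continuous.comp continuous_subtype_val).integrable_unitInterval ρ
  have hpoly (p : Polynomial ℝ) :
      ∫ r : I, p.eval (r : ℝ) ∂ν = ∫ r : I, p.eval (r : ℝ) ∂κ := by
    induction p using Polynomial.induction_on' with
    | add p q hp hq =>
      simp only [Polynomial.eval_add]
      rw [integral_add (hint ν p) (hint ν q), integral_add (hint κ p) (hint κ q), hp, hq]
    | monomial n a =>
      simp only [Polynomial.eval_monomial, integral_const_mul, h n]
  refine ext_of_forall_integral_eq_of_IsFiniteMeasure fun f => ?_
  refine eq_of_forall_dist_le fun ε hε => ?_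
  obtain ⟨p, hp⟩ := exists_polynomial_near_continuousMap 0 1 f.toContinuousMap (ε / 2)
    (by linarith)
  have hclose (ρ : Measure I) [IsProbabilityMeasure ρ] :
      |∫ r : I, p.eval (r : ℝ) ∂ρ - ∫ r, f r ∂ρ| ≤ ε / 2 := by
    rw [← integral_sub (hint ρ p) (f.integrable ρ)]
    have := norm_integral_le_of_norm_le_const (μ := ρ) (C := ε / 2)
      (ae_of_all _ fun r : I =>
        ((p.toContinuousMapOn _ - f.toContinuousMap).norm_coe_le_norm r).trans hp.le)
    simpa using this
  have h₁ := abs_le.1 (hclose ν)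
  have h₂ := abs_le.1 (hclose κ)
  rw [hpoly p] at h₁
  rw [dist_eq, abs_le]
  constructor <;> linarith

/-- A probability measure on the line whose Laplace transform is finite and at most `1` on
`[0, ∞)` gives no mass to `(-∞, 0)`. -/
theorem ae_nonneg_of_integral_exp_le_one {μ : Measure ℝ} [IsProbabilityMeasure μ]
    (hint : ∀ x : ℝ, 0 ≤ x → Integrable (fun y => exp (-x * y)) μ)
    (hle : ∀ x : ℝ, 0 ≤ x → ∫ y, exp (-x * y) ∂μ ≤ 1) : ∀ᵐ y ∂μ, 0 ≤ y := by
  have hnull (k : ℕ) : ∀ᵐ y ∂μ, -((2 : ℝ) ^ k)⁻¹ < y := by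
    set a := ((2 : ℝ) ^ k)⁻¹
    have ha : 0 < a := by positivity
    have hbound (x : ℝ) (hx : 0 ≤ x) : μ.real {y | y ≤ -a} ≤ exp (-(x * a)) := by
      have h := ProbabilityTheory.measure_le_le_exp_mul_mgf (X := fun y => y) (-a)
        (neg_nonpos.2 hx) (hint x hx)
      refine h.trans ?_
      rw [show - -x * -a = -(x * a) by ring]
      exact mul_le_of_le_one_right (exp_pos _).le (hle x hx)
    have hlim : Tendsto (fun x : ℝ => exp (-(x * a))) atTop (𝓝 0) :=
      tendsto_exp_neg_atTop_nhds_zero.comp (tendsto_id.atTop_mul_const ha)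
    have h0 : μ.real {y | y ≤ -a} ≤ 0 :=
      ge_of_tendsto hlim ((eventually_ge_atTop 0).mono hbound)
    rw [ae_iff]
    simp only [not_lt]
    exact (measureReal_eq_zero_iff).1 (le_antisymm h0 measureReal_nonneg)
  filter_upwards [ae_all_iff.2 hnull] with y hy
  simpa using le_of_tendsto' tendsto_inv_two_pow.neg fun k => (hy k).le

/-- A probability measure on `[0, ∞)` is determined by its Laplace transform. -/
theorem MeasureTheory.Measure.ext_of_integral_exp_neg_mul {μ κ : Measure ℝ}
    [IsProbabilityMeasure μ] [IsProbabilityMeasure κ] (hμ : ∀ᵐ y ∂μ, 0 ≤ y)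
    (hκ : ∀ᵐ y ∂κ, 0 ≤ y)
    (h : ∀ x : ℝ, 0 ≤ x → ∫ y, exp (-x * y) ∂μ = ∫ y, exp (-x * y) ∂κ) : μ = κ := by
  let φ : ℝ → I := fun y => Set.projIcc 0 1 zero_le_one (exp (-y))
  have hφm : Measurable φ := (continuous_projIcc.comp (by fun_prop)).measurable
  have hφ {y : ℝ} (hy : 0 ≤ y) : (φ y : ℝ) = exp (-y) := by
    simp [φ, Set.projIcc, exp_nonneg, hy]
  have hback (ρ : Measure ℝ) (hρ : ∀ᵐ y ∂ρ, 0 ≤ y) :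
      (ρ.map φ).map (fun r : I => -log (r : ℝ)) = ρ := by
    have hm : Measurable fun r : I => -log (r : ℝ) :=
      (measurable_log.comp measurable_subtype_coe).neg
    rw [Measure.map_map hm hφm]
    conv_rhs => rw [← Measure.map_id (μ := ρ)]
    refine Measure.map_congr ?_
    filter_upwards [hρ] with y hy
    simp [hφ hy]
  have hpow (ρ : Measure ℝ) (hρ : ∀ᵐ y ∂ρ, 0 ≤ y) (n : ℕ) :
      ∫ r : I, (r : ℝ) ^ n ∂(ρ.map φ) = ∫ y, exp (-(n : ℝ) * y) ∂ρ := by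
    rw [integral_map hφm.aemeasurable (by fun_prop)]
    refine integral_congr_ae ?_
    filter_upwards [hρ] with y hy
    rw [hφ hy, ← exp_nat_mul]
    ring_nf
  have := Measure.isProbabilityMeasure_map (μ := μ) hφm.aemeasurable
  have := Measure.isProbabilityMeasure_map (μ := κ) hφm.aemeasurable
  have heq : μ.map φ = κ.map φ := Measure.ext_of_integral_pow_unitInterval fun n => by
    rw [hpow μ hμ, hpow κ hκ, h n n.cast_nonneg]
  rw [← hback μ hμ, heq, hback κ hκ]

/-- If `F` tends to `1` at `0`, the representing measure may be taken on `[0, ∞)`. -/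
theorem IsLaplaceTransform.exists_measure_real {F : ℝ → ℝ} (hF : IsLaplaceTransform F)
    (h0 : F 0 = 1) (hlim : Tendsto F (𝓝[>] 0) (𝓝 1)) :
    ∃ ν : Measure ℝ, IsProbabilityMeasure ν ∧
      ∀ x : ℝ, 0 ≤ x → ∫ y, exp (-x * y) ∂ν = F x := by
  obtain ⟨ν, hprob, hν⟩ := hF
  have hzero : ν {0} = 0 := by
    have hle (x : ℝ) (hx : 0 < x) : ν.real {0} ≤ 1 - F x := by
      have hc := continuous_coe_rpow hx
      have hi := (continuous_const.sub hc).integrable_unitInterval ν (f := fun r => 1 - (r : ℝ) ^ x)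
      have h₁ : ν.real {0} ≤ ∫ r : I, (1 - (r : ℝ) ^ x) ∂ν := by
        rw [← integral_indicator_one (measurableSet_singleton (0 : I))]
        refine integral_mono ((integrable_const 1).indicator (measurableSet_singleton 0)) hi
          fun r => ?_
        by_cases hr : r = 0
        · simp [hr, zero_rpow hx.ne']
        · simpa [hr] using rpow_le_one r.2.1 r.2.2 hx.le
      rwa [integral_sub (integrable_const 1) (hc.integrable_unitInterval ν), hν x hx,
        integral_const, probReal_univ, one_smul] at h₁
    have h₂ : ν.real {0} ≤ 1 - 1 :=
      ge_of_tendsto (hlim.const_sub 1) (eventually_nhdsWithin_of_forall fun x hx => hle x hx)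
    rw [sub_self] at h₂
    exact (measureReal_eq_zero_iff).1 (le_antisymm h₂ measureReal_nonneg)
  have hm : Measurable fun r : I => -log (r : ℝ) :=
    (measurable_log.comp measurable_subtype_coe).neg
  have hprob' := Measure.isProbabilityMeasure_map (μ := ν) hm.aemeasurable
  refine ⟨ν.map fun r : I => -log (r : ℝ), hprob', fun x hx => ?_⟩
  rcases hx.eq_or_lt with rfl | hx
  · simp [h0]
  · rw [integral_map hm.aemeasurable (by fun_prop), ← hν x hx]
    have hne : ∀ᵐ r ∂ν, r ≠ 0 := by simpa [ae_iff] using hzero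
    refine integral_congr_ae ?_
    filter_upwards [hne] with r hr
    have hr' : 0 < (r : ℝ) := unitInterval.pos_iff_ne_zero.2 hr
    rw [rpow_def_of_pos hr']
    ring_nf

/-- A law whose Laplace transform is `exp (-f)` for a Laplace exponent `f` vanishing continuously
at `0` is infinitely divisible. -/
theorem IsLaplaceExponent.exists_pi_map_sum_eq {f : ℝ → ℝ} (hf : IsLaplaceExponent f)
    (h0 : f 0 = 0) (hlim : Tendsto f (𝓝[>] 0) (𝓝 0)) {μ : Measure ℝ} [IsProbabilityMeasure μ]
    (hμ : ∀ x : ℝ, 0 ≤ x → ∫ y, exp (-x * y) ∂μ = exp (-f x)) {n : ℕ} (hn : 0 < n) :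
    ∃ ν : Measure ℝ, IsProbabilityMeasure ν ∧
      Measure.map (fun y : Fin n → ℝ => ∑ i, y i) (Measure.pi fun _ => ν) = μ := by
  have hn' : (0 : ℝ) < n := by exact_mod_cast hn
  obtain ⟨ν, hprob, hν⟩ := (hf (n : ℝ)⁻¹ (inv_pos.2 hn')).exists_measure_real (by simp [h0])
    (by simpa [Function.comp_def] using (continuous_exp.tendsto _).comp (hlim.const_mul (-(n : ℝ)⁻¹)))
  have hm : Measurable fun y : Fin n → ℝ => ∑ i, y i := by fun_prop
  have hprob' := Measure.isProbabilityMeasure_map (μ := Measure.pi fun _ : Fin n => ν)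
    hm.aemeasurable
  have hsum (x : ℝ) (hx : 0 ≤ x) :
      ∫ y, exp (-x * y) ∂(Measure.pi fun _ : Fin n => ν).map (fun y => ∑ i, y i) =
        exp (-f x) := by
    rw [integral_map hm.aemeasurable (by fun_prop)]
    simp only [Finset.mul_sum, exp_sum]
    rw [integral_fintype_prod_eq_prod (fun _ y => exp (-x * y))]
    simp only [hν x hx, Finset.prod_const, Finset.card_univ, Fintype.card_fin]
    rw [← exp_nat_mul]
    field_simp
  have hsupp (ρ : Measure ℝ) [IsProbabilityMeasure ρ]
      (hρ : ∀ x : ℝ, 0 ≤ x → ∫ y, exp (-x * y) ∂ρ = exp (-f x)) : ∀ᵐ y ∂ρ, 0 ≤ y := by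
    refine ae_nonneg_of_integral_exp_le_one (fun x hx => ?_) fun x hx => ?_
    · by_contra hni
      exact (exp_pos (-f x)).ne ((integral_undef hni).symm.trans (hρ x hx))
    · rw [hρ x hx, exp_le_one_iff]
      rcases hx.eq_or_lt with rfl | hx
      · simp [h0]
      · linarith [hf.nonneg hx]
  exact ⟨ν, hprob, Measure.ext_of_integral_exp_neg_mul (hsupp _ hsum) (hsupp _ hμ)
    fun x hx => (hsum x hx).trans (hμ x hx).symm⟩

theorem psi_two_is_bernstein_and_infinitely_divisible
    (m : ℝ) (hm : 0 < m)
    (ψ : ℝ → ℝ)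
    (hψ : ∀ x : ℝ, ψ x = (1 / 2) * Real.log (1 + x) +
        Real.log (Real.cosh (m * Real.arsinh (Real.sqrt x)))) :
    ψ 0 = 0 ∧
    (∀ x : ℝ, 0 ≤ x → 0 ≤ ψ x) ∧
    ContDiffOn ℝ (⊤ : ℕ∞) ψ (Set.Ioi 0) ∧
    (∀ n : ℕ, 1 ≤ n → ∀ x : ℝ, 0 < x →
      0 ≤ (-1 : ℝ) ^ (n - 1) * iteratedDeriv n ψ x) ∧
    (∀ μ : Measure ℝ, IsProbabilityMeasure μ →
      (∀ x : ℝ, 0 ≤ x → ∫ y, Real.exp (-x * y) ∂μ = Real.exp (-ψ x)) →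
      ∀ n : ℕ, 0 < n → ∃ ν : Measure ℝ, IsProbabilityMeasure ν ∧
        Measure.map (fun y : Fin n → ℝ => ∑ i, y i) (Measure.pi fun _ => ν) = μ) := by
  obtain rfl : ψ = fun x => (1 / 2) * log (1 + x) + log (cosh (m * arsinh (√x))) := funext hψ
  have hexp : IsLaplaceExponent fun x =>
      (1 / 2) * log (1 + x) + log (cosh (m * arsinh (√x))) :=
    (IsLaplaceExponent.id.log_one_add.const_mul (by norm_num)).add
      (.log_cosh_mul_arsinh_sqrt hm)
  have hsmooth : ContDiffOn ℝ (⊤ : ℕ∞)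
      (fun x => (1 / 2) * log (1 + x) + log (cosh (m * arsinh (√x)))) (Set.Ioi 0) := by
    intro x hx
    have hx : 0 < x := hx
    refine ContDiffAt.contDiffWithinAt (.add (contDiffAt_const.mul ?_) ?_)
    · exact (contDiffAt_const.add contDiffAt_id).log (by simp; linarith)
    · exact ((contDiffAt_const.mul (contDiffAt_id.sqrt hx.ne').arsinh).cosh).log
        (cosh_pos _).ne'
  have hlim : Tendsto (fun x => (1 / 2) * log (1 + x) + log (cosh (m * arsinh (√x))))
      (𝓝[>] 0) (𝓝 0) := by
    have hc : ContinuousAt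
        (fun x => (1 / 2) * log (1 + x) + log (cosh (m * arsinh (√x)))) 0 := by
      refine .add (continuousAt_const.mul (.log (by fun_prop) (by simp)))
        (.log ?_ (cosh_pos _).ne')
      have := continuous_arsinh
      fun_prop
    simpa using hc.tendsto.mono_left nhdsWithin_le_nhds
  refine ⟨by simp, fun x hx => ?_, hsmooth,
    fun n hn x hx => hexp.iteratedDeriv_nonneg hsmooth hn hx,
    fun μ _ hμ n hn => hexp.exists_pi_map_sum_eq (by simp) hlim hμ hn⟩
  rcases hx.eq_or_lt with rfl | hx
  · simp
  · exact hexp.nonneg hx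
end
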